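/- Let X ∈ ℝ^{p×n} be a matrix whose columns all have unit Euclidean norm, let η > 0, let H ∈ ℝ^{p×p} be a fixed matrix all of whose entries satisfy |H_{j,l}| ≤ 1/√(ηp), let D = diag(ε) with ε ∈ {−1,+1}^p having i.i.d. uniform random sign entries, and set Y = H D X. Then for every α ∈ (0,1): P( ‖Y‖_max-row ≥ √(n/p)·√((2/η)·log(2np/α)) ) ≤ α. -/

import Mathlib

open Matrix Finset

/-- Probability of event `A` under the uniform distribution on the finite type `Ω`. -/
noncomputable def probOf {Ω : Type*} [Fintype Ω] (A : Set Ω) : ℝ :=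
  (A.ncard : ℝ) / Fintype.card Ω

/-- Expectation of `f` under the uniform distribution on the finite type `Ω`. -/
noncomputable def expec {Ω E : Type*} [Fintype Ω] [AddCommMonoid E] [Module ℝ E]
    (f : Ω → E) : E :=
  (Fintype.card Ω : ℝ)⁻¹ • ∑ ω, f ω

/-- Euclidean norm of a vector. -/
noncomputable def l2norm {ι : Type*} [Fintype ι] (v : ι → ℝ) : ℝ :=
  Real.sqrt (∑ i, v i ^ 2)

/-- Random sign vector `ε ∈ {±1}^p` built from boolean coin flips. -/
def signVec {p : ℕ} (ω : Fin p → Bool) : Fin p → ℝ := fun i => if ω i then 1 else -1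

/-- The diagonal random sign matrix `D = diag(ε)`. -/
noncomputable def signMatrix {p : ℕ} (ω : Fin p → Bool) : Matrix (Fin p) (Fin p) ℝ :=
  Matrix.diagonal (signVec ω)

/-- Sampling matrix `R ∈ ℝ^{p×m}` whose `j`-th column is the canonical basis vector `e_{σ j}`;
a uniformly random `σ : Fin m ↪ Fin p` models choosing `m` distinct canonical basis vectors
uniformly at random without replacement. -/
noncomputable def sampMatrix {p m : ℕ} (σ : Fin m ↪ Fin p) : Matrix (Fin p) (Fin m) ℝ :=
  Matrix.of fun i j => if σ j = i then 1 else 0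

/-- Spectral norm (ℓ²→ℓ² operator norm) of a square matrix. -/
noncomputable def specNorm {p : ℕ} (A : Matrix (Fin p) (Fin p) ℝ) : ℝ :=
  ‖LinearMap.toContinuousLinearMap (Matrix.toEuclideanLin A)‖

/-- `diag(A)`: the matrix obtained by zeroing all off-diagonal entries of `A`. -/
noncomputable def diagPart {p : ℕ} (A : Matrix (Fin p) (Fin p) ℝ) : Matrix (Fin p) (Fin p) ℝ :=
  Matrix.diagonal A.diag

lemma aux_mgf {p : ℕ} (a : Fin p → ℝ) :
    ∑ ω : Fin p → Bool, Real.exp (∑ l, a l * signVec ω l) ≤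
      2 ^ p * Real.exp ((∑ l, a l ^ 2) / 2) := by
  have h1 : ∑ ω : Fin p → Bool, Real.exp (∑ l, a l * signVec ω l) =
      ∏ l, ∑ b : Bool, Real.exp (a l * (if b then 1 else -1)) := by
    rw [Finset.prod_univ_sum]
    simp only [Fintype.piFinset_univ]
    refine Finset.sum_congr rfl fun ω _ => ?_
    rw [Real.exp_sum]
    rfl
  rw [h1, Finset.sum_div, Real.exp_sum]
  have h2 : (2 : ℝ) ^ p = ∏ _l : Fin p, (2 : ℝ) := by simp
  rw [h2, ← Finset.prod_mul_distrib]
  refine Finset.prod_le_prod (fun l _ => Finset.sum_nonneg fun b _ => (Real.exp_pos _).le)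
    fun l _ => ?_
  have := Real.cosh_le_exp_half_sq (a l)
  rw [Real.cosh_eq] at this
  simp only [Fintype.sum_bool, if_true, mul_one]
  simp
  linarith

lemma aux_row {n : ℕ} (hn : 0 < n) (y : Fin n → ℝ) (t : ℝ) (ht : 0 ≤ t)
    (h : Real.sqrt n * t ≤ l2norm y) : ∃ i, t ≤ |y i| := by
  by_contra! hc
  have : Nonempty (Fin n) := ⟨⟨0, hn⟩⟩
  have h1 : ∑ i, y i ^ 2 < ∑ _i : Fin n, t ^ 2 := by
    refine Finset.sum_lt_sum_of_nonempty Finset.univ_nonempty fun i _ => ?_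
    rw [← sq_abs]
    exact pow_lt_pow_left₀ (hc i) (abs_nonneg _) two_ne_zero
  simp only [Finset.sum_const, Finset.card_univ, Fintype.card_fin, nsmul_eq_mul] at h1
  have h2 : l2norm y < Real.sqrt (n * t ^ 2) :=
    Real.sqrt_lt_sqrt (Finset.sum_nonneg fun i _ => sq_nonneg _) h1
  rw [Real.sqrt_mul (Nat.cast_nonneg _), Real.sqrt_sq ht] at h2
  linarith

lemma aux_count {Ω : Type*} [Fintype Ω] (A : Set Ω) {p n : ℕ} (f g : Ω → Fin p → Fin n → ℝ)
    (hf : ∀ ω j i, 0 ≤ f ω j i) (hg : ∀ ω j i, 0 ≤ g ω j i) (c C : ℝ)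
    (hpt : ∀ ω ∈ A, c ≤ ∑ j, ∑ i, (f ω j i + g ω j i))
    (hfC : ∀ j i, ∑ ω, f ω j i ≤ C) (hgC : ∀ j i, ∑ ω, g ω j i ≤ C) :
    (A.ncard : ℝ) * c ≤ p * (n * (2 * C)) := by
  classical
  calc (A.ncard : ℝ) * c = ∑ ω ∈ A.toFinset, c := by
        rw [Finset.sum_const, nsmul_eq_mul, Set.ncard_eq_toFinset_card']
    _ ≤ ∑ ω ∈ A.toFinset, ∑ j, ∑ i, (f ω j i + g ω j i) :=
        Finset.sum_le_sum fun ω hω => hpt ω (Set.mem_toFinset.1 hω)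
    _ ≤ ∑ ω, ∑ j, ∑ i, (f ω j i + g ω j i) :=
        Finset.sum_le_sum_of_subset_of_nonneg (Finset.subset_univ _)
          fun ω _ _ => Finset.sum_nonneg fun j _ => Finset.sum_nonneg fun i _ =>
            add_nonneg (hf ω j i) (hg ω j i)
    _ = ∑ j, ∑ i, ∑ ω, (f ω j i + g ω j i) := by
        rw [Finset.sum_comm]
        exact Finset.sum_congr rfl fun j _ => Finset.sum_comm
    _ ≤ ∑ _j : Fin p, ∑ _i : Fin n, 2 * C := by
        refine Finset.sum_le_sum fun j _ => Finset.sum_le_sum fun i _ => ?_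
        rw [Finset.sum_add_distrib]
        linarith [hfC j i, hgC j i]
    _ = _ := by simp

/-- for `Y = H D X` with unit-norm columns of `X`,
`P(‖Y‖_max-row ≥ √(n/p)·√((2/η)·log(2np/α))) ≤ α`, where `‖Y‖_max-row` is the
maximum Euclidean norm of the rows of `Y`. -/
theorem stmt_2 (p n : ℕ) (hp : 0 < p) (hn : 0 < n)
    (X : Matrix (Fin p) (Fin n) ℝ) (hX : ∀ i, l2norm (fun l => X l i) = 1)
    (η : ℝ) (hη : 0 < η)
    (H : Matrix (Fin p) (Fin p) ℝ)
    (hH : ∀ j l, |H j l| ≤ 1 / Real.sqrt (η * p))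
    (α : ℝ) (hα0 : 0 < α) (hα1 : α < 1) :
    probOf {ω : Fin p → Bool |
        Real.sqrt ((n : ℝ) / p) * Real.sqrt ((2 / η) * Real.log (2 * n * p / α)) ≤
          ⨆ j, l2norm (fun i => (H * signMatrix ω * X) j i)} ≤ α := by
  set L := Real.log (2 * n * p / α) with hL
  have hp' : (0 : ℝ) < p := by exact_mod_cast hp
  have hn' : (0 : ℝ) < n := by exact_mod_cast hn
  have hp1 : (1 : ℝ) ≤ p := by exact_mod_cast hp
  have hn1 : (1 : ℝ) ≤ n := by exact_mod_cast hn
  have hLpos : 0 ≤ L := by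
    apply Real.log_nonneg
    rw [le_div_iff₀ hα0]
    nlinarith
  have hexpL : Real.exp L = 2 * n * p / α := Real.exp_log (by positivity)
  set K := η * p with hK
  have hKpos : 0 < K := by positivity
  set t := Real.sqrt (2 * L / K) with ht
  set m := K * t with hm
  have ht0 : 0 ≤ t := Real.sqrt_nonneg _
  have htsq : t ^ 2 = 2 * L / K := Real.sq_sqrt (by positivity)
  have hmt : m * t = 2 * L := by
    have : m * t = K * t ^ 2 := by rw [hm]; ring
    rw [this, htsq]; field_simp
  have hm0 : 0 ≤ m := by positivity
  have hm2 : m ^ 2 / K = 2 * L := by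
    rw [← hmt, hm]; field_simp
  have hT : Real.sqrt ((n : ℝ) / p) * Real.sqrt ((2 / η) * L) = Real.sqrt n * t := by
    rw [ht, ← Real.sqrt_mul (by positivity), ← Real.sqrt_mul (by positivity)]
    congr 1
    rw [hK]; field_simp
  rw [hT]
  set A := {ω : Fin p → Bool |
        Real.sqrt n * t ≤ ⨆ j, l2norm (fun i => (H * signMatrix ω * X) j i)} with hA
  have hY : ∀ (ω : Fin p → Bool) j i, (H * signMatrix ω * X) j i =
      ∑ l, (H j l * X l i) * signVec ω l := by
    intro ω j i
    rw [Matrix.mul_apply]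
    refine Finset.sum_congr rfl fun l _ => ?_
    rw [signMatrix, Matrix.mul_diagonal]; ring
  have hXs : ∀ i, ∑ l, X l i ^ 2 = 1 := by
    intro i
    have := hX i
    rwa [l2norm, Real.sqrt_eq_one] at this
  have hvar : ∀ j i, ∑ l, (H j l * X l i) ^ 2 ≤ 1 / K := by
    intro j i
    calc ∑ l, (H j l * X l i) ^ 2 ≤ ∑ l, 1 / K * X l i ^ 2 := by
          refine Finset.sum_le_sum fun l _ => ?_
          rw [mul_pow]
          refine mul_le_mul_of_nonneg_right ?_ (sq_nonneg _)
          have h := pow_le_pow_left₀ (abs_nonneg _) (hH j l) 2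
          rwa [sq_abs, div_pow, one_pow, Real.sq_sqrt hKpos.le] at h
      _ = 1 / K := by rw [← Finset.mul_sum, hXs, mul_one]
  have hmgf : ∀ (c : ℝ), c ^ 2 = m ^ 2 → ∀ j i,
      ∑ ω : Fin p → Bool, Real.exp (c * (H * signMatrix ω * X) j i) ≤ 2 ^ p * Real.exp L := by
    intro c hc j i
    have h := aux_mgf (fun l => c * (H j l * X l i))
    have e : ∀ ω : Fin p → Bool, c * (H * signMatrix ω * X) j i =
        ∑ l, c * (H j l * X l i) * signVec ω l := by
      intro ω
      rw [hY, Finset.mul_sum]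
      exact Finset.sum_congr rfl fun l _ => by ring
    simp only [e]
    refine h.trans ?_
    gcongr
    simp only [mul_pow c, ← Finset.mul_sum, hc]
    have := mul_le_mul_of_nonneg_left (hvar j i) (sq_nonneg m)
    have h3 : m ^ 2 * (1 / K) = 2 * L := by rw [← hm2]; ring
    linarith
  have hpt : ∀ ω ∈ A, Real.exp (2 * L) ≤ ∑ j, ∑ i,
      (Real.exp (m * (H * signMatrix ω * X) j i) +
        Real.exp (-m * (H * signMatrix ω * X) j i)) := by
    intro ω hω
    have : Nonempty (Fin p) := ⟨⟨0, hp⟩⟩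
    obtain ⟨j, hj⟩ := exists_eq_ciSup_of_finite
      (f := fun j => l2norm (fun i => (H * signMatrix ω * X) j i))
    have hω' : Real.sqrt n * t ≤ ⨆ j, l2norm (fun i => (H * signMatrix ω * X) j i) := hω
    rw [← hj] at hω'
    obtain ⟨i, hi⟩ := aux_row hn _ t ht0 hω'
    have hsum : Real.exp (m * (H * signMatrix ω * X) j i) +
        Real.exp (-m * (H * signMatrix ω * X) j i) ≤ ∑ j, ∑ i,
      (Real.exp (m * (H * signMatrix ω * X) j i) +
        Real.exp (-m * (H * signMatrix ω * X) j i)) := by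
      refine le_trans ?_ (Finset.single_le_sum (f := fun j => ∑ i,
        (Real.exp (m * (H * signMatrix ω * X) j i) +
        Real.exp (-m * (H * signMatrix ω * X) j i))) (fun j _ => by positivity)
        (Finset.mem_univ j))
      exact Finset.single_le_sum (f := fun i =>
        (Real.exp (m * (H * signMatrix ω * X) j i) +
        Real.exp (-m * (H * signMatrix ω * X) j i))) (fun j _ => by positivity)
        (Finset.mem_univ i)
    refine le_trans ?_ hsum
    rw [← hmt]
    rcases le_abs.1 hi with h | h
    · have : Real.exp (m * t) ≤ Real.exp (m * (H * signMatrix ω * X) j i) :=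
        Real.exp_le_exp.2 (mul_le_mul_of_nonneg_left h hm0)
      linarith [Real.exp_pos (-m * (H * signMatrix ω * X) j i)]
    · have : Real.exp (m * t) ≤ Real.exp (-m * (H * signMatrix ω * X) j i) :=
        Real.exp_le_exp.2 (by have := mul_le_mul_of_nonneg_left h hm0; linarith)
      linarith [Real.exp_pos (m * (H * signMatrix ω * X) j i)]
  have hmain : (A.ncard : ℝ) * Real.exp (2 * L) ≤ p * (n * (2 * (2 ^ p * Real.exp L))) := by
    exact aux_count A (fun ω j i => Real.exp (m * (H * signMatrix ω * X) j i))
      (fun ω j i => Real.exp (-m * (H * signMatrix ω * X) j i))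
      (fun _ _ _ => (Real.exp_pos _).le) (fun _ _ _ => (Real.exp_pos _).le) _ _
      hpt (hmgf m rfl) (hmgf (-m) (by ring))
  have h2L : Real.exp (2 * L) = Real.exp L * Real.exp L := by rw [← Real.exp_add]; ring_nf
  rw [probOf, div_le_iff₀ (by simp)]
  have hcard : (Fintype.card (Fin p → Bool) : ℝ) = 2 ^ p := by simp
  rw [hcard]
  have h4 : (A.ncard : ℝ) * Real.exp L ≤ p * (n * (2 * 2 ^ p)) := by
    rw [h2L] at hmain
    refine le_of_mul_le_mul_right ?_ (Real.exp_pos L)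
    linarith
  rw [hexpL, mul_div_assoc', div_le_iff₀ hα0] at h4
  refine le_of_mul_le_mul_right ?_ (show (0 : ℝ) < 2 * n * p by positivity)
  linarith
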